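/- arXiv:1004.1056 — 2 statements merged into one kernel-verified Lean document; each statement's English description precedes it below -/
import Mathlib

section
/- Let Γ be a k-regular connected graph of diameter 3 on vertex set V such that for some vertex x there exist vertices at distance 3 from x, and suppose every two adjacent vertices have exactly a₁ common neighbors while the set of vertices at distance 3 from x induces an a₃-regular graph with edges to x's neighborhood structure as in a distance-regular graph. Then, letting θ₁ be the second largest adjacency eigenvalue of Γ, we have θ₁ ≥ min{(a₁ + √(a₁² + 4k))/2, a₃}. -/
/-- A connected finite graph is distance-regular with diameter `D` and intersection
numbers `b i`, `c i` if for any vertices `x, y` at distance `i`, `y` has exactly `b i`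
neighbors at distance `i+1` from `x`, and (for `i ≥ 1`) exactly `c i` neighbors at
distance `i−1` from `x`. -/
def IsDistanceRegular {V : Type*} [Fintype V] (G : SimpleGraph V)
    (D : ℕ) (b c : ℕ → ℕ) : Prop :=
  G.Connected ∧
  (∀ x y : V, G.dist x y ≤ D) ∧ (∃ x y : V, G.dist x y = D) ∧
  (∀ (x y : V) (i : ℕ), G.dist x y = i →
      {z : V | G.Adj y z ∧ G.dist x z = i + 1}.ncard = b i) ∧
  (∀ (x y : V) (i : ℕ), 1 ≤ i → G.dist x y = i →
      {z : V | G.Adj y z ∧ G.dist x z = i - 1}.ncard = c i)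


open Matrix in
lemma rayleigh_bound {V : Type*} [Fintype V] [DecidableEq V]
    (G : SimpleGraph V) [DecidableRel G.Adj] (hc : G.Connected) (k : ℕ)
    (hreg : ∀ v, G.degree v = k) (t : ℝ)
    (hmax : ∀ μ ∈ spectrum ℝ (G.adjMatrix ℝ), μ ≠ (k : ℝ) → μ ≤ t)
    (v : V → ℝ) (hv : ∑ z, v z = 0) :
    v ⬝ᵥ (G.adjMatrix ℝ *ᵥ v) ≤ t * (v ⬝ᵥ v) := by
  have hA : (G.adjMatrix ℝ).IsHermitian := by
    have := G.isSymm_adjMatrix (α := ℝ)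
    rw [Matrix.IsHermitian, Matrix.conjTranspose_eq_transpose_of_trivial]
    exact this
  let e := hA.eigenvectorBasis
  let w : EuclideanSpace ℝ V := WithLp.toLp 2 v
  let Aw : EuclideanSpace ℝ V := WithLp.toLp 2 (G.adjMatrix ℝ *ᵥ v)
  have h1 : v ⬝ᵥ v = ∑ i, inner ℝ w (e i) * inner ℝ (e i) w := by
    rw [e.sum_inner_mul_inner w w]
    simp only [w, PiLp.inner_apply, dotProduct]
    rfl
  have h2 : v ⬝ᵥ (G.adjMatrix ℝ *ᵥ v) = ∑ i, inner ℝ w (e i) * inner ℝ (e i) Aw := by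
    rw [e.sum_inner_mul_inner w Aw]
    simp [w, Aw, PiLp.inner_apply, dotProduct, mul_comm]
  have h3 : ∀ i, inner ℝ (e i) Aw = hA.eigenvalues i * inner ℝ (e i) w := by
    intro i
    have hm := hA.mulVec_eigenvectorBasis i
    have a1 : inner ℝ (e i) Aw = (e i).ofLp ⬝ᵥ (G.adjMatrix ℝ *ᵥ v) := by
      simp [Aw, PiLp.inner_apply, dotProduct, mul_comm]
    have a2 : inner ℝ (e i) w = (e i).ofLp ⬝ᵥ v := by
      simp [w, PiLp.inner_apply, dotProduct, mul_comm]
    rw [a1, a2, dotProduct_mulVec, ← mulVec_transpose, G.isSymm_adjMatrix.eq]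
    change (G.adjMatrix ℝ *ᵥ (hA.eigenvectorBasis i).ofLp) ⬝ᵥ v = _
    rw [hm, smul_dotProduct]
    rfl
  rw [h1, h2, Finset.mul_sum]
  refine Finset.sum_le_sum fun i _ => ?_
  rw [h3]
  have hs : inner ℝ w (e i) = inner ℝ (e i) w := real_inner_comm _ _
  rw [hs]
  by_cases hi : hA.eigenvalues i = k
  · have hz : inner ℝ (e i) w = 0 := by
      have hm := hA.mulVec_eigenvectorBasis i
      have hL : G.lapMatrix ℝ *ᵥ (e i).ofLp = 0 := by
        rw [SimpleGraph.lapMatrix, sub_mulVec]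
        change _ - G.adjMatrix ℝ *ᵥ (hA.eigenvectorBasis i).ofLp = 0
        rw [hm, hi]
        ext z
        simp [SimpleGraph.degMatrix, mulVec_diagonal, hreg, e]
      rw [SimpleGraph.lapMatrix_mulVec_eq_zero_iff_forall_reachable] at hL
      obtain ⟨x⟩ := hc.nonempty
      have : inner ℝ (e i) w = ∑ z, v z * (e i).ofLp x := by
        simp only [PiLp.inner_apply]
        refine Finset.sum_congr rfl fun z _ => ?_
        rw [hL x z (hc.preconnected x z)]
        simp [w]
      rw [this, ← Finset.sum_mul, hv, zero_mul]
    rw [hz]; simp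
  · have := hmax _ (hA.eigenvalues_mem_spectrum_real i) hi
    nlinarith [mul_self_nonneg (inner ℝ (e i) w)]

open Matrix in
lemma drg_mulVec {V : Type*} [Fintype V] [DecidableEq V]
    (G : SimpleGraph V) [DecidableRel G.Adj] (hc : G.Connected) (b c : ℕ → ℕ) (k : ℕ)
    (hreg : ∀ v, G.degree v = k)
    (hb : ∀ (x y : V) (i : ℕ), G.dist x y = i →
      {z : V | G.Adj y z ∧ G.dist x z = i + 1}.ncard = b i)
    (hcc : ∀ (x y : V) (i : ℕ), 1 ≤ i → G.dist x y = i →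
      {z : V | G.Adj y z ∧ G.dist x z = i - 1}.ncard = c i)
    (x y : V) (i : ℕ) (hi : 1 ≤ i) (hxy : G.dist x y = i) (F : ℕ → ℝ) :
    (G.adjMatrix ℝ *ᵥ (fun z => F (G.dist x z))) y =
      k * F i + c i * (F (i-1) - F i) + b i * (F (i+1) - F i) ∧ b i + c i ≤ k := by
  have hb' : ((G.neighborFinset y).filter (fun z => G.dist x z = i + 1)).card = b i := by
    rw [← hb x y i hxy, ← Set.ncard_coe_finset]
    congr 1; ext z; simp
  have hc' : ((G.neighborFinset y).filter (fun z => G.dist x z = i - 1)).card = c i := by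
    rw [← hcc x y i hi hxy, ← Set.ncard_coe_finset]
    congr 1; ext z; simp
  constructor
  · rw [SimpleGraph.adjMatrix_mulVec_apply]
    have : ∀ z ∈ G.neighborFinset y, F (G.dist x z) =
        F i + (if G.dist x z = i - 1 then F (i-1) - F i else 0) +
          (if G.dist x z = i + 1 then F (i+1) - F i else 0) := by
      intro z hz
      have hz : G.Adj y z := by simpa using hz
      have h1 : G.dist x z ≤ G.dist x y + G.dist y z := hc.dist_triangle
      have h2 : G.dist x y ≤ G.dist x z + G.dist z y := hc.dist_triangle
      rw [SimpleGraph.dist_eq_one_iff_adj.2 hz] at h1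
      rw [SimpleGraph.dist_eq_one_iff_adj.2 hz.symm] at h2
      have : G.dist x z = i - 1 ∨ G.dist x z = i ∨ G.dist x z = i + 1 := by omega
      rcases this with h | h | h <;> rw [h]
      · rw [if_pos rfl, if_neg (by omega)]; ring
      · rw [if_neg (by omega), if_neg (by omega)]; ring
      · rw [if_neg (by omega), if_pos rfl]; ring
    rw [Finset.sum_congr rfl this, Finset.sum_add_distrib, Finset.sum_add_distrib,
      ← Finset.sum_filter, ← Finset.sum_filter]
    simp only [Finset.sum_const, hb', hc', nsmul_eq_mul, SimpleGraph.card_neighborFinset_eq_degree,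
      hreg]
  · rw [← hb', ← hc', ← hreg y, ← SimpleGraph.card_neighborFinset_eq_degree,
      ← Finset.card_union_of_disjoint]
    · apply Finset.card_le_card
      intro z; simp; tauto
    · rw [Finset.disjoint_left]
      intro z; simp; omega

/-- For a distance-regular graph of diameter 3 with valency `k = b 0`, the second
largest adjacency eigenvalue `θ₁` satisfies `θ₁ ≥ min ((a₁ + √(a₁²+4k))/2) a₃`,
where `a₁ = k − b 1 − c 1` and `a₃ = k − c 3`. -/
theorem second_largest_eigenvalue_lower_bound {V : Type*} [Fintype V] [DecidableEq V]
    (G : SimpleGraph V) [DecidableRel G.Adj] (b c : ℕ → ℕ)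
    (hdrg : IsDistanceRegular G 3 b c)
    (k a₁ a₃ : ℕ) (hk : k = b 0) (hk3 : 3 ≤ k)
    (ha₁ : a₁ = k - b 1 - c 1) (ha₃ : a₃ = k - c 3)
    (θ₁ : ℝ) (hmem : θ₁ ∈ spectrum ℝ (G.adjMatrix ℝ)) (hne : θ₁ ≠ (k : ℝ))
    (hmax : ∀ μ ∈ spectrum ℝ (G.adjMatrix ℝ), μ ≠ (k : ℝ) → μ ≤ θ₁) :
    θ₁ ≥ min (((a₁ : ℝ) + Real.sqrt ((a₁ : ℝ) ^ 2 + 4 * k)) / 2) (a₃ : ℝ) := by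
  obtain ⟨hc, hdiam, ⟨x, y, hxy⟩, hb, hcc⟩ := hdrg
  have hreg : ∀ v, G.degree v = k := by
    intro v
    rw [hk, ← hb v v 0 SimpleGraph.dist_self, ← SimpleGraph.card_neighborFinset_eq_degree,
      ← Set.ncard_coe_finset]
    congr 1; ext z; simp
  set s := ((a₁ : ℝ) + Real.sqrt ((a₁ : ℝ) ^ 2 + 4 * k)) / 2 with hs
  have hkpos : (3 : ℝ) ≤ k := by exact_mod_cast hk3
  have hsq : s * (s - a₁) = k := by
    have := Real.sq_sqrt (show (0:ℝ) ≤ (a₁ : ℝ) ^ 2 + 4 * k by positivity)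
    rw [hs]; nlinarith
  have hspos : 0 < s := by
    have : 0 < Real.sqrt ((a₁ : ℝ) ^ 2 + 4 * k) := Real.sqrt_pos.2 (by positivity)
    rw [hs]; positivity
  have hsa : 0 < s - a₁ := by
    by_contra h
    nlinarith
  let f : ℕ → ℝ := fun n => if n = 0 then s - a₁ else if n = 1 then 1 else 0
  let g : ℕ → ℝ := fun n => if 3 ≤ n then 1 else 0
  obtain ⟨α, hα⟩ : ∃ α, α = ∑ z, g (G.dist x z) := ⟨_, rfl⟩
  obtain ⟨β, hβ⟩ : ∃ β, β = -∑ z, f (G.dist x z) := ⟨_, rfl⟩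
  have hαpos : 0 < α := by
    rw [hα]
    apply Finset.sum_pos'
    · intro z _; simp only [g]; split_ifs <;> norm_num
    · exact ⟨y, Finset.mem_univ _, by simp [g, hxy]⟩
  let F : ℕ → ℝ := fun n => α * f n + β * g n
  let v : V → ℝ := fun z => F (G.dist x z)
  have hsum : ∑ z, v z = 0 := by
    simp only [v, F, Finset.sum_add_distrib, ← Finset.mul_sum]
    rw [← hα, hβ]
    ring
  have hR := rayleigh_bound G hc k hreg θ₁ hmax v hsum
  have hmul := drg_mulVec G hc b c k hreg hb hcc x
  have hF0 : F 0 = α * (s - a₁) := by simp [F, f, g]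
  have hF1 : F 1 = α := by simp [F, f, g]
  have hF2 : F 2 = 0 := by simp [F, f, g]
  have hF3 : ∀ n, 3 ≤ n → F n = β := by
    intro n hn
    simp [F, f, g, hn, show n ≠ 0 by omega, show n ≠ 1 by omega]
  have hlow : min s (a₃ : ℝ) * (dotProduct v v) ≤
      dotProduct v (Matrix.mulVec (G.adjMatrix ℝ) v) := by
    simp only [dotProduct, Finset.mul_sum]
    refine Finset.sum_le_sum fun z _ => ?_
    have key : v z = 0 ∨ Matrix.mulVec (G.adjMatrix ℝ) v z = s * v z ∨
        Matrix.mulVec (G.adjMatrix ℝ) v z = a₃ * v z := by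
      have hz3 : G.dist x z ≤ 3 := hdiam x z
      have hcase : G.dist x z = 0 ∨ G.dist x z = 1 ∨ G.dist x z = 2 ∨ G.dist x z = 3 := by omega
      rcases hcase with h | h | h | h
      · right; left
        have hxz : x = z := (hc.dist_eq_zero_iff).1 h
        subst hxz
        rw [SimpleGraph.adjMatrix_mulVec_apply]
        have : ∀ u ∈ G.neighborFinset x, v u = α := by
          intro u hu
          have hu : G.Adj x u := by simpa using hu
          simp only [v]
          rw [SimpleGraph.dist_eq_one_iff_adj.2 hu, hF1]
        rw [Finset.sum_congr rfl this]
        simp only [Finset.sum_const, nsmul_eq_mul, SimpleGraph.card_neighborFinset_eq_degree, hreg,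
          v, SimpleGraph.dist_self, hF0]
        rw [← hsq]; ring
      · right; left
        obtain ⟨h1, h2⟩ := hmul z 1 le_rfl h F
        have hc1 : c 1 = 1 := by
          rw [← hcc x z 1 le_rfl h, Set.ncard_eq_one]
          refine ⟨x, ?_⟩
          ext u
          simp only [Set.mem_setOf_eq, Set.mem_singleton_iff]
          constructor
          · rintro ⟨_, hu⟩
            exact ((hc.dist_eq_zero_iff).1 hu).symm
          · rintro rfl
            exact ⟨(SimpleGraph.dist_eq_one_iff_adj.1 h).symm, by simp⟩
        have ha : (a₁ : ℝ) = k - b 1 - 1 := by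
          have : a₁ + b 1 + 1 = k := by omega
          rw [← this]; push_cast; ring
        change Matrix.mulVec (G.adjMatrix ℝ) v z = _ at h1
        rw [h1]
        simp only [v, h, hc1, Nat.sub_self, Nat.reduceAdd, hF0, hF1, hF2]
        rw [ha]; push_cast; ring
      · left; simp only [v, h, hF2]
      · right; right
        obtain ⟨h1, h2⟩ := hmul z 3 (by norm_num) h F
        have ha : (a₃ : ℝ) = k - c 3 := by
          have : a₃ + c 3 = k := by omega
          rw [← this]; push_cast; ring
        change Matrix.mulVec (G.adjMatrix ℝ) v z = _ at h1
        rw [h1]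
        simp only [v, h, Nat.reduceAdd, Nat.reduceSub, hF2, hF3 3 le_rfl, hF3 4 (by norm_num)]
        rw [ha]; ring
    rcases key with h | h | h <;> rw [h]
    · simp
    · nlinarith [min_le_left s (a₃ : ℝ), mul_self_nonneg (v z)]
    · nlinarith [min_le_right s (a₃ : ℝ), mul_self_nonneg (v z)]
  have hpos : 0 < dotProduct v v := by
    apply Finset.sum_pos'
    · intro z _; exact mul_self_nonneg _
    · refine ⟨x, Finset.mem_univ _, ?_⟩
      simp only [v, SimpleGraph.dist_self, hF0]
      positivity
  exact le_of_mul_le_mul_right (hlow.trans hR) hpos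
end

section
/- Let Γ be a distance-regular graph with diameter 3 whose intersection array satisfies a₃ = 0 (i.e., c₃ = k). If additionally the second largest eigenvalue θ₁ satisfies θ₁ ≤ 1, then the smallest eigenvalue θ₃ satisfies θ₃ ≤ −k; consequently Γ is bipartite. -/
theorem mem_spec_of_eigvec {V : Type*} [Fintype V] [DecidableEq V]
    (A : Matrix V V ℝ) (f : V → ℝ) (μ : ℝ) (x : V) (hx : f x ≠ 0)
    (h : ∀ y, A.mulVec f y = μ * f y) : μ ∈ spectrum ℝ A := by
  rw [← Matrix.spectrum_toLin']
  apply Module.End.HasEigenvalue.mem_spectrum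
  apply Module.End.hasEigenvalue_of_hasEigenvector (x := f)
  rw [Module.End.hasEigenvector_iff, Module.End.mem_eigenspace_iff]
  refine ⟨?_, fun h0 => hx (by rw [h0]; rfl)⟩
  ext y
  simpa using h y

theorem local_count {V : Type*} [Fintype V] [DecidableEq V]
    (G : SimpleGraph V) [DecidableRel G.Adj] (b c : ℕ → ℕ)
    (hdrg : IsDistanceRegular G 3 b c) (x y : V) (i : ℕ) (hi : 1 ≤ i)
    (hxy : G.dist x y = i) :
    ∃ a : ℕ, a + b i + c i = b 0 ∧
      (∀ g : ℕ → ℝ, ∑ z ∈ G.neighborFinset y, g (G.dist x z) =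
        c i * g (i - 1) + a * g i + b i * g (i + 1)) ∧
      (a = 0 → ∀ z, G.Adj y z → G.dist x z ≠ i) := by
  obtain ⟨hconn, -, -, hb, hc⟩ := hdrg
  have hB := hb x y i hxy
  have hC := hc x y i hi hxy
  have h0 := hb y y 0 (by simp)
  have e0 : {z : V | G.Adj y z ∧ G.dist y z = 0 + 1} = (G.neighborFinset y : Set V) := by
    ext z; simp
  have eB : {z : V | G.Adj y z ∧ G.dist x z = i + 1} =
      ((G.neighborFinset y).filter (fun z => G.dist x z = i + 1) : Finset V) := by
    ext z; simp
  have eC : {z : V | G.Adj y z ∧ G.dist x z = i - 1} =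
      ((G.neighborFinset y).filter (fun z => G.dist x z = i - 1) : Finset V) := by
    ext z; simp
  rw [e0, Set.ncard_coe_finset] at h0
  rw [eB, Set.ncard_coe_finset] at hB
  rw [eC, Set.ncard_coe_finset] at hC
  have key : ∀ g : ℕ → ℝ, ∑ z ∈ G.neighborFinset y, g (G.dist x z) =
        c i * g (i - 1) +
        ((G.neighborFinset y).filter (fun z => G.dist x z = i)).card * g i
        + b i * g (i + 1) := by
    intro g
    have hs : ∀ z ∈ G.neighborFinset y, g (G.dist x z) =
        (if G.dist x z = i - 1 then g (i - 1) else 0) +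
        (if G.dist x z = i then g i else 0) + (if G.dist x z = i + 1 then g (i + 1) else 0) := by
      intro z hz
      have hz' : G.Adj y z := by simpa using hz
      have h1 : G.dist y z = 1 := SimpleGraph.dist_eq_one_iff_adj.2 hz'
      have h2 := hconn.dist_triangle (u := x) (v := y) (w := z)
      have h3 := hconn.dist_triangle (u := x) (v := z) (w := y)
      rw [SimpleGraph.dist_comm (u := z)] at h3
      have : G.dist x z = i - 1 ∨ G.dist x z = i ∨ G.dist x z = i + 1 := by omega
      rcases this with h | h | h
      · rw [h, if_pos rfl, if_neg (by omega), if_neg (by omega)]; simp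
      · rw [h, if_pos rfl, if_neg (by omega), if_neg (by omega)]; simp
      · rw [h, if_pos rfl, if_neg (by omega), if_neg (by omega)]; simp
    rw [Finset.sum_congr rfl hs, Finset.sum_add_distrib, Finset.sum_add_distrib,
      ← Finset.sum_filter, ← Finset.sum_filter, ← Finset.sum_filter]
    simp only [Finset.sum_const, nsmul_eq_mul, hB, hC]
  refine ⟨_, ?_, key, ?_⟩
  · have := key (fun _ => 1)
    simp only [Finset.sum_const, nsmul_eq_mul, mul_one, h0] at this
    have h' : b 0 = c i + ((G.neighborFinset y).filter (fun z => G.dist x z = i)).card + b i := by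
      exact_mod_cast this
    omega
  · intro h z hz hd
    rw [Finset.card_eq_zero] at h
    have : z ∈ (G.neighborFinset y).filter (fun z => G.dist x z = i) := by simp [hz, hd]
    rw [h] at this
    simp at this

/-- A distance-regular graph of diameter 3 with `a₃ = 0` (i.e. `c 3 = k`) and second
largest eigenvalue `θ₁ ≤ 1` has smallest eigenvalue `θ₃ ≤ −k`; consequently it is
bipartite. -/
theorem a3_zero_theta1_le_one_bipartite {V : Type*} [Fintype V] [DecidableEq V]
    (G : SimpleGraph V) [DecidableRel G.Adj] (b c : ℕ → ℕ)
    (hdrg : IsDistanceRegular G 3 b c)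
    (k : ℕ) (hk : k = b 0) (hk3 : 3 ≤ k) (ha₃ : c 3 = k)
    (θ₁ : ℝ) (hmem₁ : θ₁ ∈ spectrum ℝ (G.adjMatrix ℝ)) (hne₁ : θ₁ ≠ (k : ℝ))
    (hmax₁ : ∀ μ ∈ spectrum ℝ (G.adjMatrix ℝ), μ ≠ (k : ℝ) → μ ≤ θ₁)
    (hθ₁ : θ₁ ≤ 1)
    (θ₃ : ℝ) (hmem₃ : θ₃ ∈ spectrum ℝ (G.adjMatrix ℝ))
    (hmin₃ : ∀ μ ∈ spectrum ℝ (G.adjMatrix ℝ), θ₃ ≤ μ) :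
    θ₃ ≤ -(k : ℝ) ∧ G.Colorable 2 := by
  have hloc := local_count G b c hdrg
  obtain ⟨hconn, hle, ⟨x, y, hxy⟩, hb, hc⟩ := id hdrg
  -- degrees
  have hdeg : ∀ v, (G.neighborFinset v).card = k := by
    intro v
    have h0 := hb v v 0 (by simp)
    have e0 : {z : V | G.Adj v z ∧ G.dist v z = 0 + 1} = (G.neighborFinset v : Set V) := by
      ext z; simp
    rw [e0, Set.ncard_coe_finset] at h0
    rw [h0, hk]
  -- vertices at distance 2 and 1
  obtain ⟨z, hz, hxz⟩ : ∃ z, G.Adj y z ∧ G.dist x z = 2 := by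
    have h := hc x y 3 (by norm_num) hxy
    have hne : {z : V | G.Adj y z ∧ G.dist x z = 3 - 1}.Nonempty := by
      apply Set.nonempty_of_ncard_ne_zero; omega
    exact hne
  obtain ⟨w, hw, hxw⟩ : ∃ w, G.Adj z w ∧ G.dist x w = 1 := by
    obtain ⟨p, hp⟩ := hconn.exists_walk_length_eq_dist z x
    rw [SimpleGraph.dist_comm, hxz] at hp
    cases p with
    | nil => simp at hp
    | cons h q =>
      rename_i w
      refine ⟨w, h, ?_⟩
      have h1 := SimpleGraph.dist_le q
      have h2 := hconn.dist_triangle (u := x) (v := w) (w := z)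
      have h3 : G.dist z w = 1 := SimpleGraph.dist_eq_one_iff_adj.2 h
      rw [SimpleGraph.dist_comm] at h3
      rw [SimpleGraph.dist_comm] at h1
      simp only [SimpleGraph.Walk.length_cons] at hp
      omega
  have hb2 : 1 ≤ b 2 := by
    rw [← hb x z 2 hxz, Nat.succ_le_iff, Set.ncard_pos (Set.toFinite _)]
    exact ⟨y, hz.symm, hxy⟩
  have hb1 : 1 ≤ b 1 := by
    rw [← hb x w 1 hxw, Nat.succ_le_iff, Set.ncard_pos (Set.toFinite _)]
    exact ⟨z, hw.symm, hxz⟩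
  have hc1 : c 1 = 1 := by
    rw [← hc x w 1 le_rfl hxw, Set.ncard_eq_one]
    refine ⟨x, ?_⟩
    ext v
    simp only [Set.mem_ofPred_eq, Set.mem_singleton_iff, Nat.sub_self]
    constructor
    · rintro ⟨-, h⟩
      exact (hconn.dist_eq_zero_iff.1 h).symm
    · rintro rfl
      exact ⟨(SimpleGraph.dist_eq_one_iff_adj.1 hxw).symm, by simp⟩
  obtain ⟨a1, ha1, -, -⟩ := hloc x w 1 le_rfl hxw
  obtain ⟨a2, ha2, -, -⟩ := hloc x z 2 (by norm_num) hxz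
  obtain ⟨a3, ha3, -, -⟩ := hloc x y 3 (by norm_num) hxy
  have hb3 : b 3 = 0 := by omega
  rw [← hk] at ha1 ha2 ha3
  have A1 : (a1 : ℝ) = k - 1 - b 1 := by
    have : (a1 : ℝ) + b 1 + c 1 = k := by exact_mod_cast ha1
    rw [hc1] at this; push_cast at this; linarith
  have A2 : (a2 : ℝ) = k - c 2 - b 2 := by
    have : (a2 : ℝ) + b 2 + c 2 = k := by exact_mod_cast ha2
    linarith
  have hb1R : (1 : ℝ) ≤ b 1 := by exact_mod_cast hb1
  have hb2R : (1 : ℝ) ≤ b 2 := by exact_mod_cast hb2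
  have hkR : (3 : ℝ) ≤ k := by exact_mod_cast hk3
  have hc2R : (0 : ℝ) ≤ c 2 := by positivity
  -- the key inequality
  let p : ℝ → ℝ := fun t => (t + 1) * ((t - k + b 1 + c 2) * (t + b 2) - b 2 * c 2) - b 1 * (t + b 2)
  have hp1 : 0 ≤ p 1 := by
    by_contra hneg
    push Not at hneg
    have hpk : 0 < p k := by
      have : p k = k * b 1 * (k + b 2) + (k + 1) * c 2 * k := by simp only [p]; ring
      rw [this]; positivity
    have hcont : ContinuousOn p (Set.Icc 1 (k : ℝ)) := by
      apply Continuous.continuousOn; fun_prop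
    obtain ⟨t, ⟨ht1, htk⟩, ht⟩ :=
      intermediate_value_Ioo (by linarith : (1 : ℝ) ≤ k) hcont ⟨hneg, hpk⟩
    let u : ℕ → ℝ := fun i => match i with
      | 0 => k * b 1 * b 2
      | 1 => t * b 1 * b 2
      | 2 => b 2 * (t ^ 2 - a1 * t - k)
      | 3 => (t - a2) * (t ^ 2 - a1 * t - k) - c 2 * t * b 1
      | _ => 0
    have hmem : t ∈ spectrum ℝ (G.adjMatrix ℝ) := by
      apply mem_spec_of_eigvec _ (fun v => u (G.dist x v)) t x
      · simp only [SimpleGraph.dist_self, u]; positivity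
      · intro v
        rw [SimpleGraph.adjMatrix_mulVec_apply]
        have hv := hle x v
        obtain h | h | h | h : G.dist x v = 0 ∨ G.dist x v = 1 ∨ G.dist x v = 2 ∨ G.dist x v = 3 := by
          omega
        · have hxv : x = v := hconn.dist_eq_zero_iff.1 h
          subst hxv
          have : ∀ s ∈ G.neighborFinset x, u (G.dist x s) = u 1 := by
            intro s hs
            rw [SimpleGraph.dist_eq_one_iff_adj.2 (by simpa using hs)]
          rw [Finset.sum_congr rfl this, Finset.sum_const, hdeg, h, nsmul_eq_mul]
          simp only [u]; ring
        · obtain ⟨a, ha, hs, -⟩ := hloc x v 1 le_rfl h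
          have : a = a1 := by omega
          subst this
          rw [hs, h, hc1]
          simp only [u]; push_cast; ring
        · obtain ⟨a, ha, hs, -⟩ := hloc x v 2 (by norm_num) h
          have : a = a2 := by omega
          subst this
          rw [hs, h]
          simp only [u]; ring
        · obtain ⟨a, ha, hs, -⟩ := hloc x v 3 (by norm_num) h
          have : a = 0 := by omega
          subst this
          rw [hs, h, hb3, ha₃]
          simp only [u, A1, A2]
          simp only [p] at ht
          push_cast
          linear_combination (-(t - k)) * ht
    have := hmax₁ t hmem (ne_of_lt htk)
    linarith
  -- arithmetic
  have hineq : (1 + (b 2 : ℝ)) * (2 * k - 2 - b 1) ≤ 2 * c 2 := by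
    simp only [p] at hp1; linarith
  have hb1k : (b 1 : ℝ) ≤ k - 1 := by
    have : (0 : ℝ) ≤ a1 := by positivity
    linarith
  have hbc : (b 2 : ℝ) + c 2 ≤ k := by
    have : (0 : ℝ) ≤ a2 := by positivity
    linarith
  have hb2' : b 2 = 1 := by
    by_contra hne
    have h2 : 2 ≤ b 2 := by omega
    have h2R : (2 : ℝ) ≤ b 2 := by exact_mod_cast h2
    nlinarith [mul_nonneg (by linarith : (0 : ℝ) ≤ b 2 - 2) (by linarith : (0 : ℝ) ≤ k - 1), mul_nonneg (by linarith : (0 : ℝ) ≤ 1 + (b 2 : ℝ)) (by linarith : (0 : ℝ) ≤ k - 1 - b 1)]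
  have ha10 : a1 = 0 := by
    have h : (a1 : ℝ) ≤ 0 := by
      rw [hb2'] at hineq hbc; push_cast at hineq hbc; linarith
    exact_mod_cast le_antisymm h (by positivity)
  have ha20 : a2 = 0 := by
    have h : (a2 : ℝ) ≤ 0 := by
      rw [hb2'] at hineq hbc A2; push_cast at hineq hbc A2; linarith
    exact_mod_cast le_antisymm h (by positivity)
  have hbip : ∀ v s, G.Adj v s → G.dist x s = G.dist x v + 1 ∨ G.dist x v = G.dist x s + 1 := by
    intro v s hvs
    have h1 : G.dist v s = 1 := SimpleGraph.dist_eq_one_iff_adj.2 hvs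
    have h2 := hconn.dist_triangle (u := x) (v := v) (w := s)
    have h3 := hconn.dist_triangle (u := x) (v := s) (w := v)
    rw [SimpleGraph.dist_comm (u := s)] at h3
    have hne : G.dist x s ≠ G.dist x v := by
      have hv := hle x v
      obtain h | h | h | h : G.dist x v = 0 ∨ G.dist x v = 1 ∨ G.dist x v = 2 ∨ G.dist x v = 3 := by
        omega
      · have hxv : x = v := hconn.dist_eq_zero_iff.1 h
        subst hxv
        omega
      · obtain ⟨a, ha, -, hs⟩ := hloc x v 1 le_rfl h
        rw [h]; exact hs (by omega) s hvs
      · obtain ⟨a, ha, -, hs⟩ := hloc x v 2 (by norm_num) h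
        rw [h]; exact hs (by omega) s hvs
      · obtain ⟨a, ha, -, hs⟩ := hloc x v 3 (by norm_num) h
        rw [h]; exact hs (by omega) s hvs
    omega
  constructor
  · apply hmin₃
    apply mem_spec_of_eigvec _ (fun v => (-1 : ℝ) ^ (G.dist x v)) _ x
    · simp
    · intro v
      rw [SimpleGraph.adjMatrix_mulVec_apply]
      have : ∀ s ∈ G.neighborFinset v, (-1 : ℝ) ^ (G.dist x s) = - (-1) ^ (G.dist x v) := by
        intro s hs
        rcases hbip v s (by simpa using hs) with h | h
        · rw [h, pow_succ]; ring
        · rw [h, pow_succ]; ring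
      rw [Finset.sum_congr rfl this, Finset.sum_const, hdeg, nsmul_eq_mul]
      ring
  · refine ⟨SimpleGraph.Coloring.mk (fun v => (⟨G.dist x v % 2, by omega⟩ : Fin 2)) ?_⟩
    intro v s hvs heq
    have h := congrArg Fin.val heq
    simp only at h
    rcases hbip v s hvs with h' | h' <;> omega
end
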